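/- Let 𝕋 be a time scale and α ∈ (0,1]. Let f : ℝ → ℝ be continuously differentiable and let g : 𝕋 → ℝ be continuous at every point of 𝕋^k. If g is nabla fractional differentiable of order α at t ∈ 𝕋^k, then f ∘ g is nabla fractional differentiable of order α at t with ∇^(α)(f ∘ g)(t) = (∫₀¹ f'( g(ρ(t)) + φ·(ν(t))^α·∇^(α)g(t) ) dφ) · ∇^(α)g(t). -/

import Mathlib

open Set Filter
open scoped Classical

/-- Backward jump operator on a time scale `T`. -/
noncomputable def rho (T : Set ℝ) (t : ℝ) : ℝ :=
  if ({s ∈ T | s < t}).Nonempty then sSup {s ∈ T | s < t} else t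

/-- Forward jump operator on a time scale `T`. -/
noncomputable def sigmaTS (T : Set ℝ) (t : ℝ) : ℝ :=
  if ({s ∈ T | t < s}).Nonempty then sInf {s ∈ T | t < s} else t

/-- Graininess `ν(t) = t - ρ(t)`. -/
noncomputable def nu (T : Set ℝ) (t : ℝ) : ℝ := t - rho T t

/-- `𝕋^k`: remove the minimum of `T` when it exists and is right-scattered. -/
def Tk (T : Set ℝ) : Set ℝ :=
  {t ∈ T | ¬ (IsLeast T t ∧ t < sigmaTS T t)}

/-- The set `Q = {1/q : q an odd positive integer}`. -/
def QOdd : Set ℝ := {x : ℝ | ∃ q : ℕ, Odd q ∧ 0 < q ∧ x = 1 / (q : ℝ)}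

/-- Real odd root power: `sign(x) * |x| ^ α`. -/
noncomputable def oddPow (α x : ℝ) : ℝ := Real.sign x * |x| ^ α

/-- The power `x ^ α` used in nabla fractional differentiation: the real odd
root when `α ∈ QOdd`, the usual real power otherwise. -/
noncomputable def fpow (α x : ℝ) : ℝ := if α ∈ QOdd then oddPow α x else x ^ α

/-- The neighborhood of `t` used in the definition of the nabla fractional
derivative: `U_δ(t)` when `α ∈ QOdd`, `U_δ⁻(t)` otherwise. -/
noncomputable def Unbhd (T : Set ℝ) (α t δ : ℝ) : Set ℝ :=
  if α ∈ QOdd then Ioo (t - δ) (t + δ) ∩ T else Ioo (t - δ) t ∩ T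

/-- `f` is nabla fractional differentiable of order `α` at `t ∈ T^k` with
derivative `L`. -/
def nablaDiffAt (T : Set ℝ) (α : ℝ) (f : ℝ → ℝ) (t L : ℝ) : Prop :=
  ∀ ε > 0, ∃ δ > 0, ∀ s ∈ Unbhd T α t δ,
    |(f (rho T t) - f s) - L * fpow α (rho T t - s)| ≤ ε * |rho T t - s| ^ α

/-- `f` is continuous at `t` in the time-scale sense. -/
def contAt (T : Set ℝ) (f : ℝ → ℝ) (t : ℝ) : Prop :=
  ∀ ε > 0, ∃ δ > 0, ∀ s ∈ Ioo (t - δ) (t + δ) ∩ T, |f t - f s| < ε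

/-- `f` is left-continuous at `t` in the time-scale sense. -/
def leftContAt (T : Set ℝ) (f : ℝ → ℝ) (t : ℝ) : Prop :=
  ∀ ε > 0, ∃ δ > 0, ∀ s ∈ Ioo (t - δ) t ∩ T, |f t - f s| < ε

/-- `f` has a local left-maximum at `t₀`. -/
def localLeftMax (T : Set ℝ) (f : ℝ → ℝ) (t₀ : ℝ) : Prop :=
  (rho T t₀ < t₀ → f (rho T t₀) ≤ f t₀) ∧
  (rho T t₀ = t₀ → ∃ δ > 0, ∀ s ∈ Ioo (t₀ - δ) t₀ ∩ T, f s ≤ f t₀)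

/-- `f` has a local left-minimum at `t₀`. -/
def localLeftMin (T : Set ℝ) (f : ℝ → ℝ) (t₀ : ℝ) : Prop :=
  (rho T t₀ < t₀ → f t₀ ≤ f (rho T t₀)) ∧
  (rho T t₀ = t₀ → ∃ δ > 0, ∀ s ∈ Ioo (t₀ - δ) t₀ ∩ T, f t₀ ≤ f s)

lemma rho_le (T : Set ℝ) (t : ℝ) : rho T t ≤ t := by
  unfold rho
  split_ifs with h
  · exact csSup_le h fun s hs => hs.2.le
  · exact le_rfl

lemma le_rho {T : Set ℝ} {s t : ℝ} (hs : s ∈ T) (hst : s < t) : s ≤ rho T t := by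
  have hmem : s ∈ {s ∈ T | s < t} := ⟨hs, hst⟩
  rw [rho, if_pos ⟨s, hmem⟩]
  exact le_csSup ⟨t, fun u hu => hu.2.le⟩ hmem

lemma oddPow_of_neg {α x : ℝ} (hx : x < 0) : oddPow α x = -(-x) ^ α := by
  rw [oddPow, Real.sign_of_neg hx, abs_of_neg hx, neg_one_mul]

lemma abs_oddPow_le (α x : ℝ) : |oddPow α x| ≤ |x| ^ α := by
  have hnonneg : 0 ≤ |x| ^ α := Real.rpow_nonneg (abs_nonneg x) α
  rw [oddPow, abs_mul, abs_of_nonneg hnonneg]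
  refine mul_le_of_le_one_left hnonneg ?_
  rcases Real.sign_apply_eq x with h | h | h <;> simp [h]

lemma Unbhd_subset (T : Set ℝ) (α t δ : ℝ) : Unbhd T α t δ ⊆ Ioo (t - δ) (t + δ) ∩ T := by
  unfold Unbhd
  split_ifs with hQ
  · exact Subset.rfl
  · rintro s ⟨⟨h1, h2⟩, hs⟩
    exact ⟨⟨h1, by linarith⟩, hs⟩

lemma Unbhd_mono {T : Set ℝ} {α t δ δ' : ℝ} (h : δ ≤ δ') : Unbhd T α t δ ⊆ Unbhd T α t δ' := by
  unfold Unbhd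
  split_ifs
  · exact inter_subset_inter_left _ (Ioo_subset_Ioo (by linarith) (by linarith))
  · exact inter_subset_inter_left _ (Ioo_subset_Ioo (by linarith) le_rfl)

lemma abs_fpow_sub_le {T : Set ℝ} {α t δ s : ℝ} (hs : s ∈ Unbhd T α t δ) :
    |fpow α (t - s)| ≤ |t - s| ^ α := by
  unfold fpow
  unfold Unbhd at hs
  split_ifs at hs ⊢ with hQ
  · exact abs_oddPow_le α _
  · have h : 0 < t - s := sub_pos.2 hs.1.2
    rw [abs_of_pos h, abs_of_nonneg (Real.rpow_nonneg h.le α)]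

lemma exists_forall_mem_Ioo_of_eventually {T : Set ℝ} {t : ℝ} {p : ℝ → Prop}
    (h : ∀ᶠ s in nhdsWithin t T, p s) :
    ∃ δ > 0, ∀ s ∈ Ioo (t - δ) (t + δ) ∩ T, p s := by
  obtain ⟨δ, hδ, h⟩ := Metric.mem_nhdsWithin_iff.1 h
  exact ⟨δ, hδ, fun s hs => h (by rwa [Real.ball_eq_Ioo])⟩

lemma contAt.continuousWithinAt {T : Set ℝ} {g : ℝ → ℝ} {t : ℝ} (h : contAt T g t) :
    ContinuousWithinAt g T t := by
  refine Metric.continuousWithinAt_iff.2 fun ε hε => ?_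
  obtain ⟨δ, hδ, h⟩ := h ε hε
  refine ⟨δ, hδ, fun {s} hs hst => ?_⟩
  rw [dist_comm, Real.dist_eq]
  refine h s ⟨?_, hs⟩
  rwa [← Real.ball_eq_Ioo]

lemma integral_deriv_segment_mul {f : ℝ → ℝ} (hf : ContDiff ℝ 1 f) (a h : ℝ) :
    (∫ φ in (0 : ℝ)..1, deriv f (a + φ * h)) * h = f (a + h) - f a := by
  have hcont : Continuous fun φ : ℝ => deriv f (a + φ * h) :=
    (hf.continuous_deriv le_rfl).comp (by fun_prop)
  have hderiv (φ : ℝ) : HasDerivAt (fun φ => f (a + φ * h)) (deriv f (a + φ * h) * h) φ := by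
    have hin : HasDerivAt (fun φ : ℝ => a + φ * h) h φ := by
      simpa using ((hasDerivAt_id φ).mul_const h).const_add a
    exact ((hf.differentiable one_ne_zero _).hasDerivAt).comp φ hin
  rw [← intervalIntegral.integral_mul_const,
    intervalIntegral.integral_eq_sub_of_hasDerivAt (fun φ _ => hderiv φ)
      ((hcont.mul continuous_const).intervalIntegrable 0 1)]
  simp

/-- At a point with `ρ(t) = t` the nabla fractional derivative obeys the usual chain rule. -/
lemma nablaDiffAt.comp_of_rho_eq {T : Set ℝ} {α t G d : ℝ} {f g : ℝ → ℝ}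
    (hρ : rho T t = t) (hf : HasDerivAt f d (g t)) (hg : contAt T g t)
    (hgdiff : nablaDiffAt T α g t G) : nablaDiffAt T α (f ∘ g) t (d * G) := by
  intro ε hε
  have hη : 0 < ε / (2 * (|G| + 1)) := by positivity
  have hκ : 0 < min 1 (ε / (2 * (|d| + 1))) := by positivity
  obtain ⟨δ₁, hδ₁, h₁⟩ := hgdiff _ hκ
  obtain ⟨δ₂, hδ₂, h₂⟩ := exists_forall_mem_Ioo_of_eventually
    (hg.continuousWithinAt.eventually (hf.isLittleO.def hη))
  refine ⟨min δ₁ δ₂, lt_min hδ₁ hδ₂, fun s hs => ?_⟩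
  have hs₁ := Unbhd_mono (min_le_left δ₁ δ₂) hs
  have hG := h₁ s hs₁
  have hF := h₂ s (Unbhd_subset T α t δ₂ (Unbhd_mono (min_le_right δ₁ δ₂) hs))
  have hp := abs_fpow_sub_le hs₁
  rw [hρ] at hG ⊢
  simp only [Function.comp_apply, smul_eq_mul, Real.norm_eq_abs] at hF ⊢
  set r := |t - s| ^ α
  set p := fpow α (t - s)
  have hr : 0 ≤ r := (abs_nonneg p).trans hp
  have hinc : |g s - g t| ≤ (|G| + 1) * r := by
    calc |g s - g t| = |(g t - g s - G * p) + G * p| := by rw [← abs_sub_comm]; ring_nf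
      _ ≤ |g t - g s - G * p| + |G| * |p| := (abs_add_le _ _).trans_eq (by rw [abs_mul])
      _ ≤ 1 * r + |G| * r := by
          gcongr
          exact hG.trans (mul_le_mul_of_nonneg_right (min_le_left _ _) hr)
      _ = (|G| + 1) * r := by ring
  have houter : |f (g s) - f (g t) - (g s - g t) * d| ≤ ε / 2 * r :=
    calc _ ≤ ε / (2 * (|G| + 1)) * ((|G| + 1) * r) := hF.trans (by gcongr)
      _ = ε / 2 * r := by field_simp
  have hinner : |d| * |g t - g s - G * p| ≤ ε / 2 * r :=
    calc _ ≤ (|d| + 1) * (ε / (2 * (|d| + 1)) * r) := by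
          gcongr
          · linarith
          · exact hG.trans (mul_le_mul_of_nonneg_right (min_le_right _ _) hr)
      _ = ε / 2 * r := by field_simp
  calc |f (g t) - f (g s) - d * G * p|
      = |-(f (g s) - f (g t) - (g s - g t) * d) + d * (g t - g s - G * p)| := by ring_nf
    _ ≤ |f (g s) - f (g t) - (g s - g t) * d| + |d| * |g t - g s - G * p| :=
        (abs_add_le _ _).trans_eq (by rw [abs_neg, abs_mul])
    _ ≤ ε * r := by linarith

/-- At a left-scattered point, for `α ∈ Q`, the nabla fractional derivative determines the
increment of the function over the jump. -/
lemma nablaDiffAt.eq_of_rho_lt {T : Set ℝ} {α t G : ℝ} {g : ℝ → ℝ} (hQ : α ∈ QOdd) (ht : t ∈ T)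
    (hρ : rho T t < t) (h : nablaDiffAt T α g t G) :
    g t = g (rho T t) + nu T t ^ α * G := by
  have hpos : 0 < nu T t ^ α := Real.rpow_pos_of_pos (sub_pos.2 hρ) α
  have hzero : |g (rho T t) - g t - G * fpow α (rho T t - t)| ≤ 0 := by
    refine le_of_forall_pos_le_add fun ε hε => ?_
    obtain ⟨δ, hδ, h⟩ := h (ε / nu T t ^ α) (by positivity)
    refine (h t (by rw [Unbhd, if_pos hQ]; exact ⟨⟨by linarith, by linarith⟩, ht⟩)).trans_eq ?_
    rw [abs_sub_comm, abs_of_pos (sub_pos.2 hρ)]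
    change ε / nu T t ^ α * nu T t ^ α = 0 + ε
    field_simp
    ring
  have heq := abs_eq_zero.1 (hzero.antisymm (abs_nonneg _))
  rw [fpow, if_pos hQ, oddPow_of_neg (sub_neg.2 hρ), neg_sub] at heq
  change _ - _ - G * -(nu T t ^ α) = 0 at heq
  linarith

/-- At a left-scattered point, for `α ∈ Q`, a continuous function with the right increment over the
jump is nabla fractional differentiable. -/
lemma nablaDiffAt_of_rho_lt {T : Set ℝ} {α t L : ℝ} {F : ℝ → ℝ} (hQ : α ∈ QOdd)
    (hρ : rho T t < t) (hF : ContinuousWithinAt F T t)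
    (heq : F t = F (rho T t) + nu T t ^ α * L) : nablaDiffAt T α F t L := by
  intro ε hε
  have hpos : 0 < nu T t ^ α := Real.rpow_pos_of_pos (sub_pos.2 hρ) α
  have hpow : ContinuousWithinAt (fun s => (s - rho T t) ^ α) T t :=
    (continuousWithinAt_id.sub continuousWithinAt_const).rpow_const (Or.inl (sub_pos.2 hρ).ne')
  have hleft : ContinuousWithinAt
      (fun s => |F (rho T t) - F s - L * -(s - rho T t) ^ α|) T t :=
    ((continuousWithinAt_const.sub hF).sub (continuousWithinAt_const.mul hpow.neg)).abs
  have hlt : |F (rho T t) - F t - L * -(t - rho T t) ^ α| < ε * (t - rho T t) ^ α := by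
    change |F (rho T t) - F t - L * -(nu T t ^ α)| < ε * nu T t ^ α
    rw [heq]
    ring_nf
    rw [abs_zero]
    positivity
  have hev := hleft.eventually_lt (continuousWithinAt_const.mul hpow) hlt
  have hgt : ∀ᶠ s in nhdsWithin t T, rho T t < s :=
    nhdsWithin_le_nhds (Ioi_mem_nhds hρ)
  obtain ⟨δ, hδ, h⟩ := exists_forall_mem_Ioo_of_eventually (hev.and hgt)
  refine ⟨δ, hδ, fun s hs => ?_⟩
  obtain ⟨h, hs⟩ := h s (Unbhd_subset T α t δ hs)
  rw [fpow, if_pos hQ, oddPow_of_neg (sub_neg.2 hs), neg_sub, abs_sub_comm (rho T t) s,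
    abs_of_pos (sub_pos.2 hs)]
  exact h.le

/-- At a left-scattered point, for `α ∉ Q`, the defining condition is vacuous. -/
lemma nablaDiffAt_of_rho_lt_of_notMem {T : Set ℝ} {α t : ℝ} (F : ℝ → ℝ) (L : ℝ) (hQ : α ∉ QOdd)
    (hρ : rho T t < t) : nablaDiffAt T α F t L := by
  refine fun ε _ => ⟨t - rho T t, sub_pos.2 hρ, fun s hs => ?_⟩
  rw [Unbhd, if_neg hQ] at hs
  exact absurd (le_rho hs.2 hs.1.2) (by linarith [hs.1.1])

/-- Chain Rule 2: for `f ∈ C¹(ℝ)` and `g` continuous on `𝕋^k`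
and nabla fractional differentiable of order `α` at `t ∈ 𝕋^k`,
`∇^(α)(f ∘ g)(t) = (∫₀¹ f'(g(ρ(t)) + φ (ν t)^α ∇^(α)g(t)) dφ) · ∇^(α)g(t)`. -/
theorem stmt13 (T : Set ℝ) (hTne : T.Nonempty) (hTcl : IsClosed T)
    (α : ℝ) (hα : α ∈ Set.Ioc (0 : ℝ) 1)
    (f g : ℝ → ℝ) (hf : ContDiff ℝ 1 f)
    (hgcont : ∀ u ∈ Tk T, contAt T g u)
    (t : ℝ) (ht : t ∈ Tk T)
    (G : ℝ) (hgdiff : nablaDiffAt T α g t G) :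
    nablaDiffAt T α (f ∘ g) t
      ((∫ φ in (0 : ℝ)..1, deriv f (g (rho T t) + φ * ((nu T t) ^ α * G))) * G) := by
  rcases (rho_le T t).lt_or_eq with hρ | hρ
  · by_cases hQ : α ∈ QOdd
    · refine nablaDiffAt_of_rho_lt hQ hρ
        (hf.continuous.continuousAt.comp_continuousWithinAt (hgcont t ht).continuousWithinAt) ?_
      have hint := integral_deriv_segment_mul hf (g (rho T t)) (nu T t ^ α * G)
      rw [← hgdiff.eq_of_rho_lt hQ ht.1 hρ] at hint
      simp only [Function.comp_apply]
      linarith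
    · exact nablaDiffAt_of_rho_lt_of_notMem _ _ hQ hρ
  · have hν : nu T t ^ α = 0 := by rw [nu, hρ, sub_self, Real.zero_rpow hα.1.ne']
    simpa [hν, hρ] using hgdiff.comp_of_rho_eq hρ
      (hf.differentiable one_ne_zero (g t)).hasDerivAt (hgcont t ht)
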